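/- Let M be a q-isometry (Mᵀ J M = J). Then exactly one of the following three alternatives holds: (i) the powers of M are bounded (there exists C > 0 with ‖Mᵏ‖ ≤ C for all k ∈ ℕ); (ii) ‖Mᵏ‖ grows quadratically (there exist c, C > 0 with c·k² ≤ ‖Mᵏ‖ ≤ C·k² for all k ≥ 1); (iii) ‖Mᵏ‖ grows exponentially (there exist λ > 1 and c, C > 0 with c·λᵏ ≤ ‖Mᵏ‖ ≤ C·λᵏ for all k ≥ 1). -/

import Mathlib

open Matrix

noncomputable section

/-- The Minkowski form matrix `diag(1, -1, …, -1)` on `ℝ^{n+1}`. -/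
def Jmat (n : ℕ) : Matrix (Fin (n + 1)) (Fin (n + 1)) ℝ :=
  Matrix.diagonal fun i => if i = 0 then (1 : ℝ) else -1

/-- The operator norm of a square real matrix, acting on Euclidean space. -/
def matOpNorm {m : ℕ} (M : Matrix (Fin m) (Fin m) ℝ) : ℝ :=
  ‖Matrix.toEuclideanCLM (𝕜 := ℝ) M‖

/-- The powers of `M` are bounded (elliptic growth). -/
def BddGrowth (n : ℕ) (M : Matrix (Fin (n + 1)) (Fin (n + 1)) ℝ) : Prop :=
  ∃ C : ℝ, 0 < C ∧ ∀ k : ℕ, matOpNorm (M ^ k) ≤ C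

/-- `‖Mᵏ‖` grows quadratically (parabolic growth). -/
def QuadGrowth (n : ℕ) (M : Matrix (Fin (n + 1)) (Fin (n + 1)) ℝ) : Prop :=
  ∃ c C : ℝ, 0 < c ∧ 0 < C ∧ ∀ k : ℕ, 1 ≤ k →
    c * (k : ℝ) ^ 2 ≤ matOpNorm (M ^ k) ∧ matOpNorm (M ^ k) ≤ C * (k : ℝ) ^ 2

/-- `‖Mᵏ‖` grows exponentially (loxodromic growth). -/
def ExpGrowth (n : ℕ) (M : Matrix (Fin (n + 1)) (Fin (n + 1)) ℝ) : Prop :=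
  ∃ lam : ℝ, 1 < lam ∧ ∃ c C : ℝ, 0 < c ∧ 0 < C ∧ ∀ k : ℕ, 1 ≤ k →
    c * lam ^ k ≤ matOpNorm (M ^ k) ∧ matOpNorm (M ^ k) ≤ C * lam ^ k


/-- Minkowski bilinear form. -/
def Bf {n : ℕ} (x y : Fin (n + 1) → ℝ) : ℝ := x 0 * y 0 - ∑ i : Fin n, x i.succ * y i.succ

/-- closed forward cone -/
def Cone {n : ℕ} (x : Fin (n + 1) → ℝ) : Prop := 0 ≤ x 0 ∧ 0 ≤ Bf x x

lemma Bf_eq {n : ℕ} (x y : Fin (n + 1) → ℝ) : Bf x y = x ⬝ᵥ (Jmat n *ᵥ y) := by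
  simp [Bf, Jmat, dotProduct, Matrix.mulVec_diagonal, Fin.sum_univ_succ, sub_eq_add_neg]

lemma Bf_comm {n : ℕ} (x y : Fin (n + 1) → ℝ) : Bf x y = Bf y x := by
  simp [Bf, mul_comm]

lemma Bf_add_left {n : ℕ} (x y z : Fin (n + 1) → ℝ) : Bf (x + y) z = Bf x z + Bf y z := by
  simp only [Bf_eq, add_dotProduct]

lemma Bf_sub_left {n : ℕ} (x y z : Fin (n + 1) → ℝ) : Bf (x - y) z = Bf x z - Bf y z := by
  simp only [Bf_eq, sub_dotProduct]

lemma Bf_smul_left {n : ℕ} (c : ℝ) (x z : Fin (n + 1) → ℝ) : Bf (c • x) z = c * Bf x z := by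
  simp only [Bf_eq, smul_dotProduct, smul_eq_mul]

lemma Bf_add_right {n : ℕ} (x y z : Fin (n + 1) → ℝ) : Bf z (x + y) = Bf z x + Bf z y := by
  rw [Bf_comm, Bf_add_left, Bf_comm x, Bf_comm y]

lemma Bf_sub_right {n : ℕ} (x y z : Fin (n + 1) → ℝ) : Bf z (x - y) = Bf z x - Bf z y := by
  rw [Bf_comm, Bf_sub_left, Bf_comm x, Bf_comm y]

lemma Bf_smul_right {n : ℕ} (c : ℝ) (x z : Fin (n + 1) → ℝ) : Bf z (c • x) = c * Bf z x := by
  rw [Bf_comm, Bf_smul_left, Bf_comm x]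

lemma Bf_iso {n : ℕ} {M : Matrix (Fin (n + 1)) (Fin (n + 1)) ℝ}
    (hM : Mᵀ * Jmat n * M = Jmat n) (x y : Fin (n + 1) → ℝ) :
    Bf (M *ᵥ x) (M *ᵥ y) = Bf x y := by
  have h : Bf x y = x ⬝ᵥ ((Mᵀ * Jmat n * M) *ᵥ y) := by rw [hM, Bf_eq]
  rw [Bf_eq, h, ← Matrix.mulVec_mulVec, ← Matrix.mulVec_mulVec,
    Matrix.dotProduct_mulVec x, Matrix.vecMul_transpose]

lemma J_sq (n : ℕ) : Jmat n * Jmat n = 1 := by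
  rw [Jmat, Matrix.diagonal_mul_diagonal, ← Matrix.diagonal_one]
  congr 1
  ext i
  split_ifs <;> norm_num

lemma iso_transpose {n : ℕ} {M : Matrix (Fin (n + 1)) (Fin (n + 1)) ℝ}
    (hM : Mᵀ * Jmat n * M = Jmat n) : Mᵀᵀ * Jmat n * Mᵀ = Jmat n := by
  have h1 : (Jmat n * Mᵀ * Jmat n) * M = 1 := by
    rw [Matrix.mul_assoc, Matrix.mul_assoc, ← Matrix.mul_assoc Mᵀ, hM, J_sq]
  have h2 := mul_eq_one_comm.mp h1
  rw [Matrix.transpose_transpose]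
  calc M * Jmat n * Mᵀ = (M * (Jmat n * Mᵀ * Jmat n)) * Jmat n := by
        simp only [Matrix.mul_assoc, J_sq, Matrix.mul_one]
    _ = Jmat n := by rw [h2, Matrix.one_mul]

lemma iso_pow {n : ℕ} {M : Matrix (Fin (n + 1)) (Fin (n + 1)) ℝ}
    (hM : Mᵀ * Jmat n * M = Jmat n) (k : ℕ) : (M ^ k)ᵀ * Jmat n * (M ^ k) = Jmat n := by
  induction k with
  | zero => simp
  | succ k ih =>
    rw [pow_succ, Matrix.transpose_mul]
    calc Mᵀ * (M ^ k)ᵀ * Jmat n * (M ^ k * M)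
        = Mᵀ * ((M ^ k)ᵀ * Jmat n * (M ^ k)) * M := by simp only [Matrix.mul_assoc]
      _ = Jmat n := by rw [ih, hM]

/-- time vector -/
def e0 (n : ℕ) : Fin (n + 1) → ℝ := Pi.single 0 1

lemma e0_zero (n : ℕ) : e0 n 0 = 1 := by simp [e0]
lemma e0_succ (n : ℕ) (i : Fin n) : e0 n i.succ = 0 := by simp [e0]
lemma Bf_e0 {n : ℕ} (x : Fin (n + 1) → ℝ) : Bf (e0 n) x = x 0 := by
  simp [Bf, e0_zero, e0_succ]
lemma mul_e0 {n : ℕ} (M : Matrix (Fin (n + 1)) (Fin (n + 1)) ℝ) (i) :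
    (M *ᵥ e0 n) i = M i 0 := by
  simp [e0]
lemma cone_e0 (n : ℕ) : Cone (e0 n) := by
  constructor
  · simp [e0_zero]
  · rw [Bf_e0, e0_zero]; norm_num

lemma CS {n : ℕ} (x y : Fin n → ℝ) :
    (∑ i, x i * y i) ^ 2 ≤ (∑ i, x i * x i) * (∑ i, y i * y i) := by
  have := Finset.sum_mul_sq_le_sq_mul_sq Finset.univ x y
  simpa only [pow_two] using this

lemma sum_sq_nn {n : ℕ} (x : Fin n → ℝ) : 0 ≤ ∑ i, x i * x i :=
  Finset.sum_nonneg fun i _ => mul_self_nonneg _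

lemma cone_pair {n : ℕ} {x y : Fin (n + 1) → ℝ} (hx : Cone x) (hy : Cone y) : 0 ≤ Bf x y := by
  obtain ⟨hx0, hx⟩ := hx
  obtain ⟨hy0, hy⟩ := hy
  unfold Bf at *
  have h := CS (fun i : Fin n => x i.succ) (fun i => y i.succ)
  have h1 := sum_sq_nn (fun i : Fin n => x i.succ)
  have h2 := sum_sq_nn (fun i : Fin n => y i.succ)
  have h3 : (∑ i : Fin n, x i.succ * y i.succ) ^ 2 ≤ (x 0 * y 0) ^ 2 := by
    refine h.trans ?_
    calc _ ≤ (x 0 * x 0) * (y 0 * y 0) := by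
          apply mul_le_mul <;> linarith
      _ = _ := by ring
  have := abs_le_of_sq_le_sq' h3 (by positivity)
  linarith [this.2]

lemma cone_add {n : ℕ} {x y : Fin (n + 1) → ℝ} (hx : Cone x) (hy : Cone y) : Cone (x + y) := by
  refine ⟨add_nonneg hx.1 hy.1, ?_⟩
  rw [Bf_add_left, Bf_add_right, Bf_add_right, Bf_comm y x]
  linarith [cone_pair hx hy, hx.2, hy.2]

lemma cone_smul {n : ℕ} {x : Fin (n + 1) → ℝ} (hx : Cone x) {c : ℝ} (hc : 0 ≤ c) :
    Cone (c • x) := by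
  refine ⟨mul_nonneg hc hx.1, ?_⟩
  rw [Bf_smul_left, Bf_smul_right]
  exact mul_nonneg hc (mul_nonneg hc hx.2)

lemma cone_zero_eq {n : ℕ} {x : Fin (n + 1) → ℝ} (hx : 0 ≤ Bf x x) (h0 : x 0 = 0) : x = 0 := by
  unfold Bf at hx
  rw [h0] at hx
  have h1 := sum_sq_nn (fun i : Fin n => x i.succ)
  have h2 : ∑ i : Fin n, x i.succ * x i.succ = 0 := by linarith
  rw [Finset.sum_eq_zero_iff_of_nonneg (fun i _ => mul_self_nonneg _)] at h2
  ext i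
  refine Fin.cases h0 (fun j => ?_) i
  simpa using h2 j (Finset.mem_univ _)

/-- Timelike vectors control the time coordinate. -/
lemma timelike_ctrl {n : ℕ} {z : Fin (n + 1) → ℝ} (hz : 0 < Bf z z) :
    ∃ c : ℝ, 0 < c ∧ ∀ y, Cone y → c * y 0 ≤ |Bf y z| := by
  unfold Bf at hz
  set s := ∑ i : Fin n, z i.succ * z i.succ with hs
  have hs0 : 0 ≤ s := sum_sq_nn (fun i : Fin n => z i.succ)
  have hlt : √s < |z 0| := by
    rw [Real.sqrt_lt' ]
    · rw [sq_abs]; nlinarith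
    · rw [abs_pos]; rintro h; rw [h] at hz; linarith
  refine ⟨|z 0| - √s, by linarith, fun y hy => ?_⟩
  obtain ⟨hy0, hy⟩ := hy
  unfold Bf at *
  have h := CS (fun i : Fin n => y i.succ) (fun i => z i.succ)
  have h3 : (∑ i : Fin n, y i.succ * z i.succ) ^ 2 ≤ (y 0 * √s) ^ 2 := by
    refine h.trans ?_
    rw [mul_pow, Real.sq_sqrt hs0]
    apply mul_le_mul_of_nonneg_right _ hs0
    nlinarith
  have h4 := sq_le_sq.mp h3
  rw [abs_of_nonneg (by positivity : 0 ≤ y 0 * √s)] at h4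
  have h5 := abs_sub_abs_le_abs_sub (y 0 * z 0) (∑ i : Fin n, y i.succ * z i.succ)
  rw [abs_mul, abs_of_nonneg hy0] at h5
  linarith

lemma null_par {n : ℕ} {a b : Fin (n + 1) → ℝ} (ha : Bf a a = 0) (hb : Bf b b = 0)
    (hab : Bf a b = 0) : b 0 • a = a 0 • b := by
  have h : Bf (b 0 • a - a 0 • b) (b 0 • a - a 0 • b) = 0 := by
    simp only [Bf_sub_left, Bf_sub_right, Bf_smul_left, Bf_smul_right, ha, hb, hab, Bf_comm b a]
    ring
  have := cone_zero_eq h.ge (by simp [mul_comm])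
  exact sub_eq_zero.mp this

lemma col_zero {n : ℕ} {M : Matrix (Fin (n + 1)) (Fin (n + 1)) ℝ}
    (hM : Mᵀ * Jmat n * M = Jmat n) : M 0 0 * M 0 0 - ∑ i : Fin n, M i.succ 0 * M i.succ 0 = 1 := by
  have := Bf_iso hM (e0 n) (e0 n)
  rw [Bf_e0, e0_zero] at this
  simpa only [Bf, mul_e0] using this

lemma col_succ {n : ℕ} {M : Matrix (Fin (n + 1)) (Fin (n + 1)) ℝ}
    (hM : Mᵀ * Jmat n * M = Jmat n) (j : Fin n) :
    M 0 j.succ * M 0 j.succ - ∑ i : Fin n, M i.succ j.succ * M i.succ j.succ = -1 := by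
  have := Bf_iso hM (Pi.single j.succ 1) (Pi.single j.succ 1)
  simpa [Bf, Pi.single_apply] using this

lemma one_le_sq {n : ℕ} {M : Matrix (Fin (n + 1)) (Fin (n + 1)) ℝ}
    (hM : Mᵀ * Jmat n * M = Jmat n) : 1 ≤ M 0 0 * M 0 0 := by
  have := col_zero hM
  have h1 := sum_sq_nn (fun i : Fin n => M i.succ 0)
  linarith

lemma entry_bound {n : ℕ} {M : Matrix (Fin (n + 1)) (Fin (n + 1)) ℝ}
    (hM : Mᵀ * Jmat n * M = Jmat n) (i j) : |M i j| ≤ 2 * |M 0 0| := by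
  have h1 := one_le_sq hM
  have hcol : ∀ i, M i 0 * M i 0 ≤ M 0 0 * M 0 0 := by
    intro i
    refine Fin.cases le_rfl (fun i => ?_) i
    have h3 := Finset.single_le_sum (f := fun i : Fin n => M i.succ 0 * M i.succ 0)
      (fun i _ => mul_self_nonneg _) (Finset.mem_univ i)
    have := col_zero hM
    linarith
  have hrow : ∀ j, M 0 j * M 0 j ≤ M 0 0 * M 0 0 := by
    intro j
    refine Fin.cases le_rfl (fun j => ?_) j
    have h3 := Finset.single_le_sum (f := fun i : Fin n => M 0 i.succ * M 0 i.succ)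
      (fun i _ => mul_self_nonneg _) (Finset.mem_univ j)
    have := col_zero (iso_transpose hM)
    simp only [Matrix.transpose_apply] at h3 this
    linarith
  have key : M i j * M i j ≤ 4 * (M 0 0 * M 0 0) := by
    revert i j
    intro i j
    refine Fin.cases ?_ (fun j => ?_) j
    · linarith [hcol i]
    refine Fin.cases ?_ (fun i => ?_) i
    · linarith [hrow j.succ]
    have h3 := Finset.single_le_sum (f := fun i : Fin n => M i.succ j.succ * M i.succ j.succ)
      (fun i _ => mul_self_nonneg _) (Finset.mem_univ i)
    have := col_succ hM j
    linarith [hrow j.succ]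
  have : (M i j) ^ 2 ≤ (2 * M 0 0) ^ 2 := by nlinarith
  have := sq_le_sq.mp this
  rwa [abs_mul, abs_two] at this

lemma opNorm_upper (n : ℕ) : ∃ C : ℝ, 0 < C ∧ ∀ M : Matrix (Fin (n + 1)) (Fin (n + 1)) ℝ,
    Mᵀ * Jmat n * M = Jmat n → matOpNorm M ≤ C * |M 0 0| := by
  let T : (Fin (n + 1) → Fin (n + 1) → ℝ) →ₗ[ℝ]
      (EuclideanSpace ℝ (Fin (n + 1)) →L[ℝ] EuclideanSpace ℝ (Fin (n + 1))) :=
    { toFun := fun A => Matrix.toEuclideanCLM (𝕜 := ℝ) (Matrix.of A)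
      map_add' := fun A B => by
        rw [← map_add]; rfl
      map_smul' := fun c A => by
        rw [RingHom.id_apply, ← map_smul]; rfl }
  let T' := LinearMap.toContinuousLinearMap T
  refine ⟨(‖T'‖ + 1) * 2, by positivity, fun M hM => ?_⟩
  have h1 : matOpNorm M = ‖T' (fun i j => M i j)‖ := rfl
  have h2 : ‖(fun i j => M i j : Fin (n + 1) → Fin (n + 1) → ℝ)‖ ≤ 2 * |M 0 0| := by
    rw [pi_norm_le_iff_of_nonneg (by positivity)]
    intro i
    rw [pi_norm_le_iff_of_nonneg (by positivity)]
    intro j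
    exact entry_bound hM i j
  rw [h1]
  refine (T'.le_opNorm _).trans ?_
  rw [mul_assoc]
  gcongr
  linarith

lemma opNorm_eig {m : ℕ} {M : Matrix (Fin m) (Fin m) ℝ} {v : Fin m → ℝ} {c : ℝ}
    (hv : v ≠ 0) (h : M *ᵥ v = c • v) : |c| ≤ matOpNorm M := by
  have h1 : Matrix.toEuclideanCLM (𝕜 := ℝ) M (WithLp.toLp 2 v) = c • WithLp.toLp 2 v := by
    rw [Matrix.toEuclideanCLM_toLp, h]; rfl
  have h2 := (Matrix.toEuclideanCLM (𝕜 := ℝ) M).le_opNorm (WithLp.toLp 2 v)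
  rw [h1, norm_smul, Real.norm_eq_abs] at h2
  refine le_of_mul_le_mul_right h2 ?_
  rw [norm_pos_iff]
  simpa using hv

lemma opNorm_lower {n : ℕ} (M : Matrix (Fin (n + 1)) (Fin (n + 1)) ℝ) :
    |M 0 0| ≤ matOpNorm M := by
  have h2 := (Matrix.toEuclideanCLM (𝕜 := ℝ) M).le_opNorm (EuclideanSpace.single 0 1)
  rw [PiLp.norm_single, norm_one, mul_one] at h2
  refine le_trans ?_ h2
  refine le_trans (le_of_eq ?_) (PiLp.norm_apply_le _ 0)
  have : (EuclideanSpace.single 0 1 : EuclideanSpace ℝ (Fin (n+1))) = WithLp.toLp 2 (e0 n) := by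
    rfl
  rw [this, Matrix.toEuclideanCLM_toLp, Real.norm_eq_abs]
  simp [mul_e0]

lemma cone_map {n : ℕ} {M : Matrix (Fin (n + 1)) (Fin (n + 1)) ℝ}
    (hM : Mᵀ * Jmat n * M = Jmat n) (h0 : 0 < M 0 0) {x} (hx : Cone x) : Cone (M *ᵥ x) := by
  refine ⟨?_, by rw [Bf_iso hM]; exact hx.2⟩
  have hr : Cone (Jmat n *ᵥ (M 0)) := by
    have := col_zero (iso_transpose hM)
    simp only [Matrix.transpose_apply] at this
    constructor
    · simp [Jmat, Matrix.mulVec_diagonal, h0.le]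
    · simp [Bf, Jmat, Matrix.mulVec_diagonal]
      linarith
  have h := cone_pair hx hr
  rw [Bf_eq, Matrix.mulVec_mulVec, J_sq, Matrix.one_mulVec, dotProduct_comm] at h
  exact h

lemma cone_pow {n : ℕ} {M : Matrix (Fin (n + 1)) (Fin (n + 1)) ℝ}
    (hM : Mᵀ * Jmat n * M = Jmat n) (h0 : 0 < M 0 0) {x} (hx : Cone x) (k : ℕ) :
    Cone (M ^ k *ᵥ x) := by
  induction k with
  | zero => simpa using hx
  | succ k ih =>
    rw [pow_succ', ← Matrix.mulVec_mulVec]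
    exact cone_map hM h0 ih

lemma one_le_pow_zero {n : ℕ} {M : Matrix (Fin (n + 1)) (Fin (n + 1)) ℝ}
    (hM : Mᵀ * Jmat n * M = Jmat n) (h0 : 0 < M 0 0) (k : ℕ) : 1 ≤ (M ^ k) 0 0 := by
  have h1 := (cone_pow hM h0 (cone_e0 n) k).1
  rw [mul_e0] at h1
  have h2 := one_le_sq (iso_pow hM k)
  nlinarith

lemma eig_pow {m : ℕ} {M : Matrix (Fin m) (Fin m) ℝ} {v : Fin m → ℝ} {c : ℝ}
    (h : M *ᵥ v = c • v) (k : ℕ) : M ^ k *ᵥ v = c ^ k • v := by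
  induction k with
  | zero => simp
  | succ k ih =>
    rw [pow_succ, ← Matrix.mulVec_mulVec, h, Matrix.mulVec_smul, ih, smul_smul, pow_succ, mul_comm]

lemma Bf_cont {n : ℕ} : Continuous fun p : (Fin (n + 1) → ℝ) × (Fin (n + 1) → ℝ) => Bf p.1 p.2 := by
  unfold Bf
  fun_prop

lemma Bf_cont_self {n : ℕ} : Continuous fun p : (Fin (n + 1) → ℝ) => Bf p p :=
  Bf_cont.comp (continuous_id.prodMk continuous_id)

lemma cone_closed (n : ℕ) : IsClosed {x : Fin (n + 1) → ℝ | Cone x} := by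
  have h1 : IsClosed {x : Fin (n + 1) → ℝ | 0 ≤ x 0} :=
    isClosed_le continuous_const (continuous_apply 0)
  have h2 : IsClosed {x : Fin (n + 1) → ℝ | 0 ≤ Bf x x} :=
    isClosed_le continuous_const Bf_cont_self
  exact h1.inter h2

lemma cone_coord {n : ℕ} {x : Fin (n + 1) → ℝ} (hx : Cone x) (i) : |x i| ≤ x 0 := by
  refine Fin.cases ?_ (fun i => ?_) i
  · rw [abs_of_nonneg hx.1]
  · have h := hx.2
    unfold Bf at h
    have h3 := Finset.single_le_sum (f := fun i : Fin n => x i.succ * x i.succ)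
      (fun i _ => mul_self_nonneg _) (Finset.mem_univ i)
    have : (x i.succ) ^ 2 ≤ (x 0) ^ 2 := by nlinarith
    have := sq_le_sq.mp this
    rwa [abs_of_nonneg hx.1] at this

lemma cone_interior {n : ℕ} {z : Fin (n + 1) → ℝ} (hz : 0 ≤ z 0) (hz' : 0 < Bf z z)
    (x : Fin (n + 1) → ℝ) : ∃ ε : ℝ, 0 < ε ∧ Cone (z - ε • x) := by
  have hz0 : 0 < z 0 := by
    refine lt_of_le_of_ne hz fun h => ?_
    have := cone_zero_eq hz'.le h.symm
    rw [this] at hz'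
    simp [Bf] at hz'
  have c1 : Continuous fun ε : ℝ => (z - ε • x) := by fun_prop
  have c2 : Continuous fun ε : ℝ => (z - ε • x) 0 := (continuous_apply 0).comp c1
  have c3 : Continuous fun ε : ℝ => Bf (z - ε • x) (z - ε • x) := Bf_cont_self.comp c1
  have e2 : ∀ᶠ ε in nhds (0:ℝ), 0 < (z - ε • x) 0 :=
    c2.continuousAt.eventually_const_lt (by simpa using hz0)
  have e3 : ∀ᶠ ε in nhds (0:ℝ), 0 < Bf (z - ε • x) (z - ε • x) :=
    c3.continuousAt.eventually_const_lt (by simpa using hz')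
  have e4 := (e2.and e3).filter_mono (nhdsWithin_le_nhds (s := Set.Ioi 0))
  obtain ⟨ε, h, hε⟩ := (e4.and self_mem_nhdsWithin).exists
  exact ⟨ε, hε, h.1.le, h.2.le⟩

lemma eig_exists {n : ℕ} {M : Matrix (Fin (n + 1)) (Fin (n + 1)) ℝ}
    (hM : Mᵀ * Jmat n * M = Jmat n) (h0 : 0 < M 0 0) :
    ∃ (v : Fin (n + 1) → ℝ) (μ : ℝ), Cone v ∧ v ≠ 0 ∧ M *ᵥ v = μ • v := by
  let K : Set ((Fin (n + 1) → ℝ) × ℝ) :=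
    {p | p.1 0 = 1 ∧ Cone p.1 ∧ 0 ≤ p.2 ∧ Cone (M *ᵥ p.1 - p.2 • p.1)}
  have hKc : IsClosed K := by
    have k1 : IsClosed {p : (Fin (n + 1) → ℝ) × ℝ | p.1 0 = 1} :=
      isClosed_eq (by fun_prop) continuous_const
    have k2 : IsClosed {p : (Fin (n + 1) → ℝ) × ℝ | Cone p.1} :=
      (cone_closed n).preimage continuous_fst
    have k3 : IsClosed {p : (Fin (n + 1) → ℝ) × ℝ | 0 ≤ p.2} :=
      isClosed_le continuous_const continuous_snd
    have k4 : IsClosed {p : (Fin (n + 1) → ℝ) × ℝ | Cone (M *ᵥ p.1 - p.2 • p.1)} :=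
      (cone_closed n).preimage (f := fun p : (Fin (n + 1) → ℝ) × ℝ => M *ᵥ p.1 - p.2 • p.1)
        (by fun_prop)
    exact k1.inter (k2.inter (k3.inter k4))
  have hsub : K ⊆ (Set.univ.pi fun _ => Set.Icc (-1) 1) ×ˢ Set.Icc 0 (∑ j, |M 0 j|) := by
    rintro ⟨x, t⟩ ⟨hx1, hx, ht, hc⟩
    simp only at hx1 hx ht hc
    have hb : ∀ i, |x i| ≤ 1 := fun i => (cone_coord hx i).trans hx1.le
    refine ⟨fun i _ => abs_le.mp (hb i), ht, ?_⟩
    have h1 := hc.1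
    simp only [Pi.sub_apply, Pi.smul_apply, hx1, smul_eq_mul, mul_one] at h1
    have h2 : (M *ᵥ x) 0 ≤ ∑ j, |M 0 j| := by
      simp only [Matrix.mulVec, dotProduct]
      refine Finset.sum_le_sum fun j _ => ?_
      calc M 0 j * x j ≤ |M 0 j * x j| := le_abs_self _
        _ = |M 0 j| * |x j| := abs_mul _ _
        _ ≤ |M 0 j| * 1 := by gcongr; exact hb j
        _ = _ := mul_one _
    show t ≤ _
    linarith
  have hcomp : IsCompact K :=
    ((isCompact_univ_pi fun _ => isCompact_Icc).prod isCompact_Icc).of_isClosed_subset hKc hsub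
  have hne : K.Nonempty := by
    refine ⟨(e0 n, 0), e0_zero n, cone_e0 n, le_rfl, ?_⟩
    simp only [zero_smul, sub_zero]
    exact cone_map hM h0 (cone_e0 n)
  obtain ⟨⟨v, t⟩, ⟨hv1, hv, ht, hw⟩, hmax⟩ := hcomp.exists_isMaxOn hne continuous_snd.continuousOn
  simp only at hv1 hv ht hw
  set w := M *ᵥ v - t • v with hwdef
  by_cases hw0 : w = 0
  · refine ⟨v, t, hv, ?_, sub_eq_zero.mp (hwdef ▸ hw0)⟩
    rintro rfl
    simp at hv1
  have hMw := cone_map hM h0 hw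
  have hz := cone_add hMw hw
  have hq : ¬ 0 < Bf (M *ᵥ w + w) (M *ᵥ w + w) := by
    intro hpos
    obtain ⟨ε, hε, hc⟩ := cone_interior hz.1 hpos (M *ᵥ v + v)
    have hMv := cone_map hM h0 hv
    have hx := cone_add hMv hv
    have hx0 : 0 < (M *ᵥ v + v) 0 := by
      have := hMv.1
      rw [Pi.add_apply, hv1]; linarith
    set x := M *ᵥ v + v with hxdef
    have e : M *ᵥ x - (t + ε) • x = M *ᵥ w + w - ε • x := by
      rw [hwdef, hxdef]
      simp only [Matrix.mulVec_add, Matrix.mulVec_sub, Matrix.mulVec_smul]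
      module
    have hmem : ((x 0)⁻¹ • x, t + ε) ∈ K := by
      refine ⟨?_, cone_smul hx (inv_nonneg.mpr hx0.le), by simp only; linarith, ?_⟩
      · simp [hx0.ne']
      · have := cone_smul hc (inv_nonneg.mpr hx0.le)
        rw [← e] at this
        simp only [Matrix.mulVec_smul]
        convert this using 1
        module
    have := hmax hmem
    simp only [Set.mem_ofPred_eq] at this
    linarith
  have e : Bf (M *ᵥ w + w) (M *ᵥ w + w) = 2 * Bf w w + 2 * Bf (M *ᵥ w) w := by
    simp only [Bf_add_left, Bf_add_right, Bf_iso hM, Bf_comm w (M *ᵥ w)]; ring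
  have p1 := cone_pair hMw hw
  have p2 := hw.2
  have q1 : Bf w w = 0 := by linarith
  have q2 : Bf (M *ᵥ w) w = 0 := by linarith
  have h := null_par (by rw [Bf_iso hM, q1]) q1 q2
  have hw00 : w 0 ≠ 0 := fun h => hw0 (cone_zero_eq p2 h)
  refine ⟨w, (w 0)⁻¹ * (M *ᵥ w) 0, hw, hw0, ?_⟩
  rw [mul_smul, ← h, smul_smul, inv_mul_cancel₀ hw00, one_smul]

/-- cocycle dichotomy in a Euclidean space -/
lemma cocycle {H : Type*} [NormedAddCommGroup H] [InnerProductSpace ℝ H] [FiniteDimensional ℝ H]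
    (U : H →ₗ[ℝ] H) (hU : ∀ x, ‖U x‖ = ‖x‖) (b : H) (β : ℕ → H) (h0 : β 0 = 0)
    (hs : ∀ k, β (k + 1) = U (β k) + b) :
    (∃ C : ℝ, ∀ k, ‖β k‖ ≤ C) ∨
    (∃ c C : ℝ, 0 < c ∧ ∀ k : ℕ, c * k ≤ ‖β k‖ ∧ ‖β k‖ ≤ C * k) := by
  obtain ⟨r, hr, f, hf, hbf⟩ := (LinearMap.range (U - 1)).exists_add_mem_mem_orthogonal b
  obtain ⟨c, rfl⟩ := hr
  simp only [LinearMap.sub_apply, Module.End.one_apply] at hbf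
  by_cases hf0 : f = 0
  · left
    refine ⟨‖c‖ + ‖c‖, fun k => ?_⟩
    have h : β k = (U ^ k) c - c := by
      induction k with
      | zero => simp [h0]
      | succ k ih =>
        rw [hs, ih, hbf, hf0, pow_succ', Module.End.mul_apply, map_sub]
        abel
    have h2 : ‖(U ^ k) c‖ = ‖c‖ := by
      clear h
      induction k with
      | zero => simp
      | succ k ih => rw [pow_succ', Module.End.mul_apply, hU, ih]
    rw [h]
    exact (norm_sub_le _ _).trans (by rw [h2])
  · right
    have hUf : ∀ x, inner ℝ (U x) f = inner ℝ x f := by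
      intro x
      have := hf ((U - 1) x) ⟨x, rfl⟩
      rw [LinearMap.sub_apply, Module.End.one_apply, inner_sub_left] at this
      linarith
    have hfp : 0 < ‖f‖ := norm_pos_iff.mpr hf0
    have hin : ∀ k : ℕ, inner ℝ (β k) f = k * ‖f‖ ^ 2 := by
      intro k
      induction k with
      | zero => simp [h0]
      | succ k ih =>
        rw [hs, inner_add_left, hUf, ih, hbf, inner_add_left, inner_sub_left, hUf,
          real_inner_self_eq_norm_sq]
        push_cast; ring
    refine ⟨‖f‖, ‖b‖, hfp, fun k => ⟨?_, ?_⟩⟩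
    · have := real_inner_le_norm (β k) f
      rw [hin] at this
      nlinarith
    · induction k with
      | zero => simp [h0]
      | succ k ih =>
        rw [hs]
        refine (norm_add_le _ _).trans ?_
        rw [hU]; push_cast; linarith

lemma par_case {n : ℕ} {M : Matrix (Fin (n + 1)) (Fin (n + 1)) ℝ}
    (hM : Mᵀ * Jmat n * M = Jmat n) {v : Fin (n + 1) → ℝ}
    (hv1 : v 0 = 1) (hvn : Bf v v = 0) (hMv : M *ᵥ v = v) :
    (∃ C : ℝ, ∀ k, (M ^ k) 0 0 ≤ C) ∨
    (∃ c C : ℝ, 0 < c ∧ ∀ k : ℕ, c * k ^ 2 ≤ (M ^ k) 0 0 - 1 ∧ (M ^ k) 0 0 - 1 ≤ C * k ^ 2) := by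
  let H : Submodule ℝ (EuclideanSpace ℝ (Fin (n + 1))) :=
    { carrier := {x | x.ofLp 0 = 0 ∧ Bf x.ofLp v = 0}
      add_mem' := by
        rintro x y ⟨h1, h2⟩ ⟨h3, h4⟩
        refine ⟨by simp [h1, h3], ?_⟩
        rw [WithLp.ofLp_add, Bf_add_left, h2, h4, add_zero]
      zero_mem' := by
        refine ⟨by simp, by simp [Bf]⟩
      smul_mem' := by
        rintro c x ⟨h1, h2⟩
        refine ⟨by simp [h1], ?_⟩
        rw [WithLp.ofLp_smul, Bf_smul_left, h2, mul_zero] }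
  let P : (Fin (n + 1) → ℝ) → EuclideanSpace ℝ (Fin (n + 1)) := fun y => WithLp.toLp 2 (y - y 0 • v)
  have hPmem : ∀ y, Bf y v = 0 → P y ∈ H := by
    intro y hy
    refine ⟨by simp [P, hv1], ?_⟩
    simp only [P, Bf_sub_left, Bf_smul_left, hy, hvn]; ring
  have hMB : ∀ y, Bf (M *ᵥ y) v = Bf y v := fun y => by
    conv_lhs => rw [← hMv]
    rw [Bf_iso hM]
  let U0 : EuclideanSpace ℝ (Fin (n + 1)) →ₗ[ℝ] EuclideanSpace ℝ (Fin (n + 1)) :=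
    { toFun := fun x => P (M *ᵥ x.ofLp)
      map_add' := fun x y => by
        simp only [P, WithLp.ofLp_add, Matrix.mulVec_add, ← WithLp.toLp_add, Pi.add_apply]
        congr 1; module
      map_smul' := fun c x => by
        simp only [P, WithLp.ofLp_smul, Matrix.mulVec_smul, ← WithLp.toLp_smul, Pi.smul_apply,
          RingHom.id_apply, smul_eq_mul]
        congr 1; module }
  have hU0 : ∀ x ∈ H, U0 x ∈ H := fun x hx => hPmem _ (by rw [hMB]; exact hx.2)
  let U : H →ₗ[ℝ] H := U0.restrict hU0
  have hnorm : ∀ x ∈ H, ‖x‖ ^ 2 = - Bf x.ofLp x.ofLp := by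
    rintro x ⟨h1, h2⟩
    rw [EuclideanSpace.norm_sq_eq, Fin.sum_univ_succ]
    simp only [Bf, h1]
    simp [pow_two]
  have hPB : ∀ y, Bf y v = 0 → Bf (P y).ofLp (P y).ofLp = Bf y y := by
    intro y hy
    simp only [P, Bf_sub_left, Bf_smul_left, Bf_sub_right, Bf_smul_right, hy, hvn, Bf_comm v y]
    ring
  have hUn : ∀ x, ‖U x‖ = ‖x‖ := by
    rintro ⟨x, hx⟩
    have h1 : ‖U ⟨x, hx⟩‖ = ‖U0 x‖ := rfl
    have h2 : ‖(⟨x, hx⟩ : H)‖ = ‖x‖ := rfl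
    rw [h1, h2, ← sq_eq_sq₀ (norm_nonneg _) (norm_nonneg _), hnorm _ (hU0 x hx), hnorm x hx]
    have := hPB (M *ᵥ x.ofLp) (by rw [hMB]; exact hx.2)
    rw [Bf_iso hM] at this
    exact congrArg Neg.neg this
  let y : ℕ → (Fin (n + 1) → ℝ) := fun k => M ^ k *ᵥ e0 n - e0 n
  have hyv : ∀ k, Bf (y k) v = 0 := by
    intro k
    have : Bf (M ^ k *ᵥ e0 n) v = Bf (e0 n) v := by
      induction k with
      | zero => simp
      | succ k ih => rw [pow_succ', ← Matrix.mulVec_mulVec, hMB, ih]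
    simp only [y]
    rw [Bf_sub_left, this, sub_self]
  have hrec : ∀ k, P (y (k + 1)) = U0 (P (y k)) + P (y 1) := by
    intro k
    have e1 : y (k + 1) = M *ᵥ (y k) + y 1 := by
      simp only [y, pow_one, Matrix.mulVec_sub, Matrix.mulVec_mulVec, ← pow_succ']
      abel
    show P (y (k + 1)) = P (M *ᵥ (y k - y k 0 • v)) + P (y 1)
    rw [e1]
    simp only [P, Matrix.mulVec_sub, Matrix.mulVec_smul, hMv, ← WithLp.toLp_add, Pi.add_apply,
      Pi.sub_apply, Pi.smul_apply, hv1, smul_eq_mul]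
    congr 1
    module
  have ha : ∀ k, ‖P (y k)‖ ^ 2 = 2 * ((M ^ k) 0 0 - 1) := by
    intro k
    rw [hnorm _ (hPmem _ (hyv k)), hPB _ (hyv k)]
    simp only [y, Bf_sub_left, Bf_sub_right, Bf_iso (iso_pow hM k),
      Bf_comm (M ^ k *ᵥ e0 n) (e0 n), Bf_e0, mul_e0, e0_zero]
    ring
  rcases cocycle U hUn ⟨P (y 1), hPmem _ (hyv 1)⟩ (fun k => ⟨P (y k), hPmem _ (hyv k)⟩)
    (by
      apply Subtype.ext
      simp [P, y]) (fun k => Subtype.ext (hrec k)) with ⟨C, h⟩ | ⟨c, C, hc, h⟩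
  · left
    refine ⟨C ^ 2 / 2 + 1, fun k => ?_⟩
    have h1 : ‖P (y k)‖ ≤ C := h k
    have h2 := pow_le_pow_left₀ (norm_nonneg _) h1 2
    rw [ha] at h2
    linarith
  · right
    refine ⟨c ^ 2 / 2, C ^ 2 / 2, by positivity, fun k => ?_⟩
    have h1 : c * k ≤ ‖P (y k)‖ := (h k).1
    have h2 : ‖P (y k)‖ ≤ C * k := (h k).2
    have h3 := pow_le_pow_left₀ (by positivity) h1 2
    have h4 := pow_le_pow_left₀ (norm_nonneg _) h2 2
    rw [ha] at h3 h4
    constructor <;> nlinarith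

lemma timelike_case {n : ℕ} {M : Matrix (Fin (n + 1)) (Fin (n + 1)) ℝ}
    (hM : Mᵀ * Jmat n * M = Jmat n) (h0 : 0 < M 0 0) {v : Fin (n + 1) → ℝ}
    (hvn : 0 < Bf v v) (hMv : M *ᵥ v = v) : ∃ C : ℝ, ∀ k, (M ^ k) 0 0 ≤ C := by
  obtain ⟨c, hc, h⟩ := timelike_ctrl hvn
  refine ⟨|v 0| / c, fun k => ?_⟩
  have h1 := h _ (cone_pow hM h0 (cone_e0 n) k)
  have hk : M ^ k *ᵥ v = v := by
    have := eig_pow (c := 1) (by simpa using hMv) k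
    simpa using this
  have h2 : Bf (M ^ k *ᵥ e0 n) v = v 0 := by
    conv_lhs => rw [← hk]
    rw [Bf_iso (iso_pow hM k), Bf_e0]
  rw [h2, mul_e0] at h1
  rw [le_div_iff₀ hc]; linarith

lemma eig_inv {n : ℕ} {M : Matrix (Fin (n + 1)) (Fin (n + 1)) ℝ}
    (hM : Mᵀ * Jmat n * M = Jmat n) {v : Fin (n + 1) → ℝ} {μ : ℝ} (hμ : μ ≠ 0)
    (hv : v ≠ 0) (hMv : M *ᵥ v = μ • v) : ∃ w, w ≠ 0 ∧ M *ᵥ w = μ⁻¹ • w := by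
  have h1 : (M - μ • (1 : Matrix (Fin (n + 1)) (Fin (n + 1)) ℝ)).det = 0 := by
    rw [← Matrix.exists_mulVec_eq_zero_iff]
    refine ⟨v, hv, ?_⟩
    rw [Matrix.sub_mulVec, hMv, Matrix.smul_mulVec, Matrix.one_mulVec, sub_self]
  rw [← Matrix.det_transpose, ← Matrix.exists_mulVec_eq_zero_iff] at h1
  obtain ⟨u, hu, h⟩ := h1
  rw [Matrix.transpose_sub, Matrix.transpose_smul, Matrix.transpose_one, Matrix.sub_mulVec,
    Matrix.smul_mulVec, Matrix.one_mulVec, sub_eq_zero] at h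
  refine ⟨Jmat n *ᵥ u, ?_, ?_⟩
  · intro h
    apply hu
    have := congrArg (fun x => Jmat n *ᵥ x) h
    simpa [Matrix.mulVec_mulVec, J_sq] using this
  · have h2 : (M * Jmat n * Mᵀ) *ᵥ u = Jmat n *ᵥ u := by
      have := iso_transpose hM
      rw [Matrix.transpose_transpose] at this
      rw [this]
    rw [← Matrix.mulVec_mulVec, h, Matrix.mulVec_smul] at h2
    rw [Matrix.mulVec_mulVec, ← h2, smul_smul, inv_mul_cancel₀ hμ, one_smul, ]

lemma lox_case {n : ℕ} {M : Matrix (Fin (n + 1)) (Fin (n + 1)) ℝ}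
    (hM : Mᵀ * Jmat n * M = Jmat n) (h0 : 0 < M 0 0) {v w : Fin (n + 1) → ℝ} {μ : ℝ} (hμ : 0 < μ)
    (hμ1 : μ ≠ 1) (hv : v ≠ 0) (hMv : M *ᵥ v = μ • v) (hw : w ≠ 0) (hMw : M *ᵥ w = μ⁻¹ • w) :
    ∃ C : ℝ, 0 ≤ C ∧ ∀ k, (M ^ k) 0 0 ≤ C * (μ ^ k + μ⁻¹ ^ k) := by
  have hnull : ∀ (x : Fin (n + 1) → ℝ) (a : ℝ), 0 < a → a ≠ 1 → M *ᵥ x = a • x → Bf x x = 0 := by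
    intro x a ha ha1 hx
    have := Bf_iso hM x x
    rw [hx, Bf_smul_left, Bf_smul_right] at this
    have h2 : (a - 1) * ((a + 1) * Bf x x) = 0 := by linarith
    rcases mul_eq_zero.mp h2 with h | h
    · exact absurd (by linarith) ha1
    · rcases mul_eq_zero.mp h with h | h
      · linarith
      · exact h
  have nv := hnull v μ hμ hμ1 hMv
  have nw := hnull w μ⁻¹ (by positivity) (by simpa using hμ1) hMw
  have hvw : Bf v w ≠ 0 := by
    intro h
    have hp := null_par nv nw h
    have hv0 : v 0 ≠ 0 := fun h => hv (cone_zero_eq nv.ge h)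
    have hw0 : w 0 ≠ 0 := fun h => hw (cone_zero_eq nw.ge h)
    have h1 := congrArg (fun x => (M *ᵥ x) 0) hp
    simp only [Matrix.mulVec_smul, hMv, hMw, Pi.smul_apply, smul_eq_mul] at h1
    have h2 : μ = μ⁻¹ := by
      have h3 : (v 0 * w 0) * μ = (v 0 * w 0) * μ⁻¹ := by linarith
      exact mul_left_cancel₀ (mul_ne_zero hv0 hw0) h3
    have h3 : μ * μ = 1 := by
      nth_rewrite 2 [h2]
      exact mul_inv_cancel₀ hμ.ne'
    apply hμ1
    nlinarith
  have hz : 0 < Bf (v + Bf v w • w) (v + Bf v w • w) := by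
    simp only [Bf_add_left, Bf_add_right, Bf_smul_left, Bf_smul_right, nv, nw, Bf_comm w v]
    have := mul_self_pos.mpr hvw
    linarith
  obtain ⟨c, hc, h⟩ := timelike_ctrl hz
  set s := Bf v w
  refine ⟨(|v 0| + |s * w 0|) / c, by positivity, fun k => ?_⟩
  have h1 := h _ (cone_pow hM h0 (cone_e0 n) k)
  have aux : ∀ (x : Fin (n + 1) → ℝ) (a : ℝ), 0 < a → M *ᵥ x = a • x →
      Bf (M ^ k *ᵥ e0 n) x = a⁻¹ ^ k * x 0 := by
    intro x a ha hx
    have h1 := Bf_iso (iso_pow hM k) (e0 n) x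
    rw [eig_pow hx, Bf_smul_right, Bf_e0] at h1
    rw [← h1, ← mul_assoc, ← mul_pow, inv_mul_cancel₀ ha.ne', one_pow, one_mul]
  rw [Bf_add_right, Bf_smul_right, aux v μ hμ hMv, aux w μ⁻¹ (by positivity) hMw, inv_inv,
    mul_e0] at h1
  have h2 : |μ⁻¹ ^ k * v 0 + s * (μ ^ k * w 0)| ≤ (|v 0| + |s * w 0|) * (μ ^ k + μ⁻¹ ^ k) := by
    refine (abs_add_le _ _).trans ?_
    have e : s * (μ ^ k * w 0) = μ ^ k * (s * w 0) := by ring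
    have p1 : 0 < μ ^ k := by positivity
    have p2 : 0 < μ⁻¹ ^ k := by positivity
    rw [e, abs_mul, abs_mul (μ ^ k), abs_of_pos p1, abs_of_pos p2]
    nlinarith [mul_nonneg p1.le (abs_nonneg (v 0)), mul_nonneg p2.le (abs_nonneg (s * w 0))]
  rw [div_mul_eq_mul_div, le_div_iff₀ hc]
  linarith

lemma exists_growth_pos {n : ℕ} {M : Matrix (Fin (n + 1)) (Fin (n + 1)) ℝ}
    (hM : Mᵀ * Jmat n * M = Jmat n) (h0 : 0 < M 0 0) :
    BddGrowth n M ∨ QuadGrowth n M ∨ ExpGrowth n M := by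
  obtain ⟨D, hD, hup⟩ := opNorm_upper n
  have ha1 := one_le_pow_zero hM h0
  have hup' : ∀ k, matOpNorm (M ^ k) ≤ D * (M ^ k) 0 0 := fun k => by
    have := hup _ (iso_pow hM k)
    rwa [abs_of_nonneg (by linarith [ha1 k])] at this
  have hlo : ∀ k, (M ^ k) 0 0 ≤ matOpNorm (M ^ k) := fun k =>
    (le_abs_self _).trans (opNorm_lower _)
  have hbdd : (∃ C : ℝ, ∀ k, (M ^ k) 0 0 ≤ C) → BddGrowth n M := by
    rintro ⟨C, hC⟩
    have : 1 ≤ C := (ha1 0).trans (hC 0)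
    exact ⟨D * C, by positivity, fun k => (hup' k).trans (by gcongr; exact hC k)⟩
  obtain ⟨v, μ, hv, hvne, hMv⟩ := eig_exists hM h0
  have hv0 : 0 < v 0 := lt_of_le_of_ne hv.1 fun h => hvne (cone_zero_eq hv.2 h.symm)
  have hμ : 0 < μ := by
    have hc := (cone_map hM h0 hv)
    have h1 := hc.1
    rw [hMv] at h1
    have h2 : 0 ≤ μ := by
      by_contra hneg
      rw [Pi.smul_apply, smul_eq_mul] at h1
      nlinarith
    refine lt_of_le_of_ne h2 fun h => ?_
    have h3 : (M *ᵥ v) = 0 := by rw [hMv, ← h, zero_smul]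
    have h4 : M ^ 1 *ᵥ v = 0 := by rw [pow_one, h3]
    have hB := Bf_iso hM (e0 n) v
    rw [h3, Bf_e0] at hB
    simp [Bf] at hB
    linarith
  by_cases hμ1 : μ = 1
  · rw [hμ1, one_smul] at hMv
    rcases hv.2.lt_or_eq with hpos | hnull
    · exact Or.inl (hbdd (timelike_case hM h0 hpos hMv))
    · have hv' : ((v 0)⁻¹ • v) 0 = 1 := by simp [hv0.ne']
      have hn' : Bf ((v 0)⁻¹ • v) ((v 0)⁻¹ • v) = 0 := by
        rw [Bf_smul_left, Bf_smul_right, ← hnull]; ring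
      rcases par_case hM hv' hn' (by rw [Matrix.mulVec_smul, hMv]) with hb | ⟨c, C, hc, h⟩
      · exact Or.inl (hbdd hb)
      · refine Or.inr (Or.inl ⟨c, D * (|C| + 1), hc, by positivity, fun k hk => ⟨?_, ?_⟩⟩)
        · linarith [(h k).1, hlo k]
        · refine (hup' k).trans ?_
          rw [mul_assoc]
          gcongr
          have h1 := (h k).2
          have hk' : (1 : ℝ) ≤ k := by exact_mod_cast hk
          have h2 : (1 : ℝ) ≤ (k : ℝ) ^ 2 := one_le_pow₀ hk'
          have h3 : C * (k : ℝ) ^ 2 ≤ |C| * (k : ℝ) ^ 2 := by gcongr; exact le_abs_self C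
          linarith
  · obtain ⟨w, hw, hMw⟩ := eig_inv hM hμ.ne' hvne hMv
    obtain ⟨C, hC, h⟩ := lox_case hM h0 hμ hμ1 hvne hMv hw hMw
    have l1 : ∀ k, μ ^ k ≤ matOpNorm (M ^ k) := fun k =>
      (le_abs_self _).trans (opNorm_eig hvne (eig_pow hMv k))
    have l2 : ∀ k, μ⁻¹ ^ k ≤ matOpNorm (M ^ k) := fun k =>
      (le_abs_self _).trans (opNorm_eig hw (eig_pow hMw k))
    right; right
    rcases lt_or_gt_of_ne hμ1 with hlt | hgt
    · have h1 : 1 < μ⁻¹ := (one_lt_inv₀ hμ).mpr hlt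
      refine ⟨μ⁻¹, h1, 1, D * ((C + 1) * 2), one_pos, by positivity, fun k _ => ⟨?_, ?_⟩⟩
      · rw [one_mul]; exact l2 k
      · refine (hup' k).trans ?_
        rw [mul_assoc]
        gcongr
        have a1 : μ ^ k ≤ μ⁻¹ ^ k := by gcongr; linarith
        have a2 : 0 < μ ^ k := by positivity
        nlinarith [h k]
    · have h1 : μ⁻¹ < 1 := inv_lt_one_of_one_lt₀ hgt
      refine ⟨μ, hgt, 1, D * ((C + 1) * 2), one_pos, by positivity, fun k _ => ⟨?_, ?_⟩⟩
      · rw [one_mul]; exact l1 k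
      · refine (hup' k).trans ?_
        rw [mul_assoc]
        gcongr
        have a1 : μ⁻¹ ^ k ≤ μ ^ k := by gcongr; linarith
        have a2 : 0 < μ⁻¹ ^ k := by positivity
        nlinarith [h k]

lemma matOpNorm_neg_pow {m : ℕ} (M : Matrix (Fin m) (Fin m) ℝ) (k : ℕ) :
    matOpNorm ((-M) ^ k) = matOpNorm (M ^ k) := by
  unfold matOpNorm
  rcases Nat.even_or_odd k with h | h
  · rw [h.neg_pow]
  · rw [h.neg_pow, map_neg, norm_neg]

lemma exists_growth {n : ℕ} {M : Matrix (Fin (n + 1)) (Fin (n + 1)) ℝ}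
    (hM : Mᵀ * Jmat n * M = Jmat n) :
    BddGrowth n M ∨ QuadGrowth n M ∨ ExpGrowth n M := by
  have h1 := one_le_sq hM
  rcases lt_trichotomy (M 0 0) 0 with h | h | h
  · have := exists_growth_pos (M := -M) (by simpa using hM) (by simpa using h)
    simpa only [BddGrowth, QuadGrowth, ExpGrowth, matOpNorm_neg_pow] using this
  · rw [h] at h1; norm_num at h1
  · exact exists_growth_pos hM h

lemma not_bdd_quad {n : ℕ} {M : Matrix (Fin (n + 1)) (Fin (n + 1)) ℝ}
    (h1 : BddGrowth n M) (h2 : QuadGrowth n M) : False := by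
  obtain ⟨C, hC, h⟩ := h1
  obtain ⟨c, D, hc, hD, h'⟩ := h2
  obtain ⟨k, hk⟩ := exists_nat_gt (C / c)
  have hk0 : (0 : ℝ) < k := lt_trans (by positivity) hk
  have hk1 : 1 ≤ k := by exact_mod_cast hk0
  have hk1' : (1 : ℝ) ≤ k := by exact_mod_cast hk1
  rw [div_lt_iff₀ hc] at hk
  have h3 := (h' k hk1).1
  have h4 := h k
  have : c * k ≤ c * (k : ℝ) ^ 2 := by gcongr; nlinarith
  linarith

lemma not_bdd_exp {n : ℕ} {M : Matrix (Fin (n + 1)) (Fin (n + 1)) ℝ}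
    (h1 : BddGrowth n M) (h2 : ExpGrowth n M) : False := by
  obtain ⟨C, hC, h⟩ := h1
  obtain ⟨l, hl, c, D, hc, hD, h'⟩ := h2
  obtain ⟨k, hk⟩ := pow_unbounded_of_one_lt (C / c) hl
  rw [div_lt_iff₀ hc] at hk
  have h3 := (h' (k + 1) (by omega)).1
  have h4 := h (k + 1)
  have h5 : l ^ k ≤ l ^ (k + 1) := pow_le_pow_right₀ hl.le (by omega)
  nlinarith

lemma not_quad_exp {n : ℕ} {M : Matrix (Fin (n + 1)) (Fin (n + 1)) ℝ}
    (h1 : QuadGrowth n M) (h2 : ExpGrowth n M) : False := by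
  obtain ⟨c', C, hc', hC, h⟩ := h1
  obtain ⟨l, hl, c, D, hc, hD, h'⟩ := h2
  have ht := tendsto_pow_const_div_const_pow_of_one_lt 2 hl
  have he := ht.eventually_lt_const (show (0 : ℝ) < c / C by positivity)
  obtain ⟨k, hk, hk1⟩ := (he.and (Filter.eventually_ge_atTop 1)).exists
  have h3 := (h' k hk1).1
  have h4 := (h k hk1).2
  rw [div_lt_div_iff₀ (by positivity) hC] at hk
  linarith

/-- The elliptic/parabolic/loxodromic trichotomy: for a `q`-isometry `M`, exactly
one of bounded, quadratic or exponential growth of `‖Mᵏ‖` holds. -/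
theorem stmt_9 (n : ℕ) (hn : 1 ≤ n) (M : Matrix (Fin (n + 1)) (Fin (n + 1)) ℝ)
    (hM : Mᵀ * Jmat n * M = Jmat n) :
    (BddGrowth n M ∧ ¬ QuadGrowth n M ∧ ¬ ExpGrowth n M) ∨
    (¬ BddGrowth n M ∧ QuadGrowth n M ∧ ¬ ExpGrowth n M) ∨
    (¬ BddGrowth n M ∧ ¬ QuadGrowth n M ∧ ExpGrowth n M) := by
  rcases exists_growth hM with h | h | h
  · exact Or.inl ⟨h, not_bdd_quad h, not_bdd_exp h⟩
  · exact Or.inr (Or.inl ⟨fun g => not_bdd_quad g h, h, not_quad_exp h⟩)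
  · exact Or.inr (Or.inr ⟨fun g => not_bdd_exp g h, fun g => not_quad_exp g h, h⟩)
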